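/- arXiv:2511.22650 — 9 statements merged into one kernel-verified Lean document; each statement's English description precedes it below -/
import Mathlib

section
/- Let A be a real m×n matrix of rank r. Then there exist injective maps I : Fin r → Fin m and J : Fin r → Fin n such that the r×r submatrix A(I,J) with entries A (I s) (J t) is invertible; moreover, for ANY injective I : Fin r → Fin m and J : Fin r → Fin n such that A(I,J) is invertible, the cross interpolation identity holds: A i j = Σ_{s : Fin r} Σ_{t : Fin r} A i (J s) * (A(I,J)⁻¹) s t * A (I t) j for all i : Fin m and j : Fin n (i.e., A = A(:,J) · A(I,J)⁻¹ · A(I,:)). -/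
namespace Matrix

variable {m n p K : Type*} [Field K]

/-- A matrix over a field has `A.rank` distinct linearly independent rows. -/
theorem exists_injective_linearIndependent_row [Finite m] [Fintype n] (A : Matrix m n K) :
    ∃ I : Fin A.rank → m, Function.Injective I ∧ LinearIndependent K (A.submatrix I id).row := by
  rw [rank_eq_finrank_span_row]
  obtain ⟨f, hf, -, hli⟩ := Submodule.exists_fun_fin_finrank_span_eq K (Set.range A.row)
  choose I hI using hf
  have hrow : (A.submatrix I id).row = f := funext hI
  refine ⟨I, fun a b hab => hli.injective ?_, hrow ▸ hli⟩
  rw [← hI a, ← hI b, hab]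

/-- A matrix over a field has an invertible square submatrix whose size is its rank. -/
theorem exists_injective_isUnit_submatrix [Fintype m] [Fintype n] (A : Matrix m n K) :
    ∃ I : Fin A.rank → m, ∃ J : Fin A.rank → n,
      Function.Injective I ∧ Function.Injective J ∧ IsUnit (A.submatrix I J) := by
  obtain ⟨I, hI, hli⟩ := A.exists_injective_linearIndependent_row
  have hrank : (A.submatrix I id)ᵀ.rank = A.rank := by
    rw [rank_transpose, hli.rank_matrix, Fintype.card_fin]
  obtain ⟨J, hJ, hli'⟩ := (A.submatrix I id)ᵀ.exists_injective_linearIndependent_row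
  let e := finCongr hrank.symm
  refine ⟨I, J ∘ e, hI, hJ.comp e.injective, ?_⟩
  rw [← linearIndependent_cols_iff_isUnit]
  exact hli'.comp e e.injective

/-- Rows of `A` indexed by `I` span the row space of `A` as soon as some square submatrix on
these rows is invertible and has the size of the rank. -/
theorem exists_eq_mul_submatrix_of_isUnit [Fintype m] [Fintype n] [Fintype p] [DecidableEq p]
    {A : Matrix m n K} (hr : A.rank = Fintype.card p) {I : p → m} {J : p → n}
    (h : IsUnit (A.submatrix I J)) : ∃ X : Matrix m p K, A = X * A.submatrix I id := by
  have hle : Fintype.card p ≤ (A.submatrix I id).rank := by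
    rw [← rank_of_isUnit _ h]
    exact rank_submatrix_le (A.submatrix I id) id J
  have hspan : Submodule.span K (Set.range (A.submatrix I id).row) =
      Submodule.span K (Set.range A.row) := by
    apply Submodule.eq_of_le_of_finrank_le
    · exact Submodule.span_mono (Set.range_subset_iff.2 fun s => ⟨I s, rfl⟩)
    · rwa [← rank_eq_finrank_span_row, ← rank_eq_finrank_span_row, hr]
  have hmem (i : m) : ∃ x : p → K, ∑ s, x s • (A.submatrix I id).row s = A.row i := by
    rw [← Submodule.mem_span_range_iff_exists_fun, hspan]
    exact Submodule.subset_span ⟨i, rfl⟩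
  choose X hX using hmem
  refine ⟨of X, ?_⟩
  ext i j
  simpa [mul_apply] using (congrFun (hX i) j).symm

/-- The cross interpolation identity `A = A(:,J) * A(I,J)⁻¹ * A(I,:)`. -/
theorem eq_submatrix_mul_inv_mul_submatrix [Fintype m] [Fintype n] [Fintype p] [DecidableEq p]
    {A : Matrix m n K} (hr : A.rank = Fintype.card p) {I : p → m} {J : p → n}
    (h : IsUnit (A.submatrix I J)) :
    A = A.submatrix id J * ((A.submatrix I J)⁻¹ * A.submatrix I id) := by
  obtain ⟨X, hX⟩ := exists_eq_mul_submatrix_of_isUnit hr h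
  have hcol : A.submatrix id J = X * A.submatrix I J := by
    ext i s
    exact congrFun (congrFun hX i) (J s)
  rw [hcol, Matrix.mul_assoc, mul_nonsing_inv_cancel_left _ _ ((isUnit_iff_isUnit_det _).1 h), ← hX]

end Matrix

/-- **Cross interpolation identity for real matrices.**
If `A : Matrix (Fin m) (Fin n) ℝ` has rank `r`, then there exist injective index maps
`I : Fin r → Fin m` and `J : Fin r → Fin n` such that the submatrix `A(I,J)` is invertible;
moreover, for any such injective `I`, `J` with `A(I,J)` invertible, the identity
`A = A(:,J) · A(I,J)⁻¹ · A(I,:)` holds entrywise. -/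
theorem matrix_cross_interpolation (m n r : ℕ) (A : Matrix (Fin m) (Fin n) ℝ)
    (hr : A.rank = r) :
    (∃ I : Fin r → Fin m, ∃ J : Fin r → Fin n,
      Function.Injective I ∧ Function.Injective J ∧ IsUnit (A.submatrix I J)) ∧
    (∀ (I : Fin r → Fin m) (J : Fin r → Fin n),
      Function.Injective I → Function.Injective J → IsUnit (A.submatrix I J) →
      ∀ (i : Fin m) (j : Fin n),
        A i j = ∑ s : Fin r, ∑ t : Fin r,
          A i (J s) * (A.submatrix I J)⁻¹ s t * A (I t) j) := by
  subst hr
  refine ⟨A.exists_injective_isUnit_submatrix, fun I J _ _ h i j => ?_⟩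
  have key := Matrix.eq_submatrix_mul_inv_mul_submatrix (Fintype.card_fin _).symm h
  simpa [Matrix.mul_apply, Finset.mul_sum, mul_assoc] using congrFun (congrFun key i) j
end

section
/- Let A be a real m×n matrix, and let I : Fin p → Fin m and J : Fin q → Fin n be injective maps such that the rank of the submatrix A(I,J) equals the rank of A. Then for every column index j : Fin n and every vector c : Fin q → ℝ that minimizes the function x ↦ ‖A(I,J) *ᵥ x − (fun i' => A (I i') j)‖ (Euclidean norm on Fin p → ℝ), one has A i j = Σ_{t : Fin q} c t * A i (J t) for all i : Fin m. In other words, when the cross submatrix preserves the rank, cross interpolation built from any columnwise least-squares solutions of A(I,J) x ≈ A(I,:) recovers A exactly. -/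
namespace Matrix

variable {K l m n o : Type*} [Field K] [Fintype n]

/-- A row selection that preserves the rank preserves the kernel. -/
theorem mulVec_eq_zero_of_rank_submatrix_rows {A : Matrix m n K} {I : l → m}
    (h : (A.submatrix I id).rank = A.rank) {x : n → K} (hx : A.submatrix I id *ᵥ x = 0) :
    A *ᵥ x = 0 := by
  have hle : LinearMap.ker A.mulVecLin ≤ LinearMap.ker (A.submatrix I id).mulVecLin := by
    intro y hy
    rw [LinearMap.mem_ker, mulVecLin_apply] at hy ⊢
    ext i
    exact congrFun hy (I i)
  have hfin : Module.finrank K (LinearMap.ker A.mulVecLin) =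
      Module.finrank K (LinearMap.ker (A.submatrix I id).mulVecLin) := by
    have hA := A.mulVecLin.finrank_range_add_finrank_ker
    have hS := (A.submatrix I id).mulVecLin.finrank_range_add_finrank_ker
    unfold rank at h
    omega
  have hmem : x ∈ LinearMap.ker A.mulVecLin := by
    rw [Submodule.eq_of_le_of_finrank_eq hle hfin]
    exact hx
  exact hmem

/-- A column selection that preserves the rank preserves the column space. -/
theorem exists_mulVec_eq_col_of_rank_submatrix_cols [Fintype o] {A : Matrix m n K} {J : o → n}
    (h : (A.submatrix id J).rank = A.rank) (j : n) :
    ∃ x : o → K, A.submatrix id J *ᵥ x = A.col j := by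
  have hle : LinearMap.range (A.submatrix id J).mulVecLin ≤ LinearMap.range A.mulVecLin := by
    rw [range_mulVecLin, range_mulVecLin]
    apply Submodule.span_mono
    rintro _ ⟨t, rfl⟩
    exact ⟨J t, rfl⟩
  have hmem : A.col j ∈ LinearMap.range (A.submatrix id J).mulVecLin := by
    rw [Submodule.eq_of_le_of_finrank_eq hle h, range_mulVecLin]
    exact Submodule.subset_span ⟨j, rfl⟩
  exact hmem

theorem mulVec_sum_single_sub_single [Fintype o] [DecidableEq n] (B : Matrix m n K) (J : o → n)
    (c : o → K) (j : n) :
    B *ᵥ (∑ t, c t • Pi.single (J t) 1 - Pi.single j 1) = B.submatrix id J *ᵥ c - B.col j := by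
  rw [mulVec_sub, mulVec_single_one, ← mulVecLin_apply, map_sum]
  ext i
  simp only [map_smul, mulVecLin_apply, mulVec_single_one]
  simp [mulVec, dotProduct, mul_comm]

/-- If a row selection preserves the rank, a linear relation expressing a selected column through
others extends to all rows. -/
theorem mulVec_eq_col_of_rank_submatrix_rows [Fintype o] {A : Matrix m n K} {I : l → m}
    {J : o → n}
    (h : (A.submatrix I id).rank = A.rank) {j : n} {c : o → K}
    (hc : A.submatrix I J *ᵥ c = fun i => A (I i) j) :
    A.submatrix id J *ᵥ c = A.col j := by
  classical
  have hzero := mulVec_eq_zero_of_rank_submatrix_rows h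
    (x := ∑ t, c t • Pi.single (J t) 1 - Pi.single j 1)
    (by rw [mulVec_sum_single_sub_single]; exact sub_eq_zero.mpr hc)
  rw [mulVec_sum_single_sub_single] at hzero
  exact sub_eq_zero.mp hzero

/-- A least-squares solution of a consistent system is an exact solution. -/
theorem mulVec_eq_of_isLeastSquares [Fintype m] {B : Matrix m n ℝ} {b : m → ℝ}
    {c x : n → ℝ}
    (hx : B *ᵥ x = b)
    (hc : √(∑ i, ((B *ᵥ c) i - b i) ^ 2) ≤ √(∑ i, ((B *ᵥ x) i - b i) ^ 2)) :
    B *ᵥ c = b := by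
  have hnonneg : ∀ i ∈ Finset.univ, 0 ≤ ((B *ᵥ c) i - b i) ^ 2 := fun i _ => sq_nonneg _
  simp only [hx, sub_self, ne_eq, OfNat.ofNat_ne_zero, not_false_eq_true, zero_pow,
    Finset.sum_const_zero, Real.sqrt_zero] at hc
  have hsum := le_antisymm (Real.sqrt_eq_zero'.mp (le_antisymm hc (Real.sqrt_nonneg _)))
    (Finset.sum_nonneg hnonneg)
  ext i
  exact sub_eq_zero.mp (pow_eq_zero_iff two_ne_zero |>.mp
    ((Finset.sum_eq_zero_iff_of_nonneg hnonneg).mp hsum i (Finset.mem_univ i)))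

end Matrix

/-- **Exactness of matrix cross interpolation from rank-preserving submatrices.**
If the submatrix `A(I,J)` has the same rank as `A`, then for every column `j` of `A`,
every least-squares solution `c` of `A(I,J) x ≈ A(I,:) eⱼ` (in the Euclidean norm on
`Fin p → ℝ`) reproduces the full column: `A i j = ∑ t, c t * A i (J t)` for all `i`. -/
theorem matrix_cross_ls_exact (m n p q : ℕ) (A : Matrix (Fin m) (Fin n) ℝ)
    (I : Fin p → Fin m) (J : Fin q → Fin n)
    (hI : Function.Injective I) (hJ : Function.Injective J)
    (hrank : (A.submatrix I J).rank = A.rank) :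
    ∀ (j : Fin n) (c : Fin q → ℝ),
      (∀ x : Fin q → ℝ,
        Real.sqrt (∑ i' : Fin p, ((A.submatrix I J).mulVec c i' - A (I i') j) ^ 2) ≤
        Real.sqrt (∑ i' : Fin p, ((A.submatrix I J).mulVec x i' - A (I i') j) ^ 2)) →
      ∀ i : Fin m, A i j = ∑ t : Fin q, c t * A i (J t) := by
  intro j c hc i
  have hrows : (A.submatrix I id).rank = A.rank := by
    refine le_antisymm (A.rank_submatrix_le I id) ?_
    rw [← hrank]
    exact (A.submatrix I id).rank_submatrix_le id J
  have hcols : ((A.submatrix I id).submatrix id J).rank = (A.submatrix I id).rank :=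
    hrank.trans hrows.symm
  obtain ⟨x, hx⟩ := Matrix.exists_mulVec_eq_col_of_rank_submatrix_cols hcols j
  have hexact : (A.submatrix I J).mulVec c = fun i' => A (I i') j :=
    Matrix.mulVec_eq_of_isLeastSquares hx (hc x)
  have hcol := congrFun (Matrix.mulVec_eq_col_of_rank_submatrix_rows hrows hexact) i
  simpa [Matrix.mulVec, dotProduct, mul_comm] using hcol.symm
end

section
/- Let A : Fin m → Fin n → H be a function-valued matrix, and let I : Fin p → Fin m and J : Fin q → Fin n be injective maps such that the column-rank of the submatrix A(I,J) equals the column-rank of A. Then for every j : Fin n and every c : Fin q → ℝ that minimizes the function x ↦ ‖(fun i' => Σ_{t : Fin q} x t • A (I i') (J t)) − (fun i' => A (I i') j)‖_{ℓ2(H)} (over all x : Fin q → ℝ), one has A i j = Σ_{t : Fin q} c t • A i (J t) for all i : Fin m. That is, when the cross submatrix preserves the column-rank, the function-valued cross interpolation A(:,J) A(I,J)† A(I,:) built from any columnwise least-squares solutions recovers A exactly. -/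
/-- The column-rank of a function-valued matrix `A : Fin m → Fin n → H`: the dimension of
the span of its columns in `Fin m → H`. -/
noncomputable def colRank {H : Type*} [NormedAddCommGroup H] [InnerProductSpace ℝ H]
    {m n : ℕ} (A : Fin m → Fin n → H) : ℕ :=
  Module.finrank ℝ (Submodule.span ℝ (Set.range fun j : Fin n => fun i : Fin m => A i j))

/-- If the image of a subspace `W ≤ V` under `f` has the dimension of the finite-dimensional
space `V`, then `W = V`. -/
theorem Submodule.eq_of_le_of_finrank_map_eq {K E F : Type*} [DivisionRing K] [AddCommGroup E]
    [Module K E] [AddCommGroup F] [Module K F] (f : E →ₗ[K] F) {W V : Submodule K E}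
    [FiniteDimensional K V] (hWV : W ≤ V)
    (h : Module.finrank K (W.map f) = Module.finrank K V) : W = V := by
  have : FiniteDimensional K W := Submodule.finiteDimensional_of_le hWV
  exact Submodule.eq_of_le_of_finrank_le hWV (h ▸ Submodule.finrank_map_le f W)

/-- If a linear map preserves the dimension of a finite-dimensional subspace `V`, then its
kernel meets `V` trivially. -/
theorem Submodule.disjoint_ker_of_finrank_map_eq {K E F : Type*} [DivisionRing K]
    [AddCommGroup E] [Module K E] [AddCommGroup F] [Module K F] (f : E →ₗ[K] F)
    {V : Submodule K E} [FiniteDimensional K V]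
    (h : Module.finrank K (V.map f) = Module.finrank K V) : Disjoint V (LinearMap.ker f) := by
  have hsum := (f.domRestrict V).finrank_range_add_finrank_ker
  rw [LinearMap.range_domRestrict, h] at hsum
  have hker : LinearMap.ker (f.domRestrict V) = ⊥ := Submodule.finrank_eq_zero.mp (by omega)
  rw [Submodule.disjoint_def]
  intro v hv hfv
  have : (⟨v, hv⟩ : V) ∈ LinearMap.ker (f.domRestrict V) := by simpa using hfv
  rw [hker, Submodule.mem_bot] at this
  exact congrArg Subtype.val this

/-- **Exactness of function-valued cross interpolation from rank-preserving submatrices.**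
If the submatrix `A(I,J)` of the function-valued matrix `A` has the same column-rank as `A`,
then for every column `j` of `A`, every `c : Fin q → ℝ` minimizing the `ℓ2(H)`-norm of
`A(I,J) x − A(I,:) eⱼ` reproduces the full column: `A i j = ∑ t, c t • A i (J t)`. -/
theorem funMatrix_cross_ls_exact {H : Type*} [NormedAddCommGroup H] [InnerProductSpace ℝ H]
    (m n p q : ℕ) (A : Fin m → Fin n → H)
    (I : Fin p → Fin m) (J : Fin q → Fin n)
    (hI : Function.Injective I) (hJ : Function.Injective J)
    (hrank : colRank (fun (i' : Fin p) (j' : Fin q) => A (I i') (J j')) = colRank A) :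
    ∀ (j : Fin n) (c : Fin q → ℝ),
      (∀ x : Fin q → ℝ,
        Real.sqrt (∑ i' : Fin p, ‖(∑ t : Fin q, c t • A (I i') (J t)) - A (I i') j‖ ^ 2) ≤
        Real.sqrt (∑ i' : Fin p, ‖(∑ t : Fin q, x t • A (I i') (J t)) - A (I i') j‖ ^ 2)) →
      ∀ i : Fin m, A i j = ∑ t : Fin q, c t • A i (J t) := by
  intro j c hc i
  set col : Fin n → Fin m → H := fun j i => A i j with hcol
  set V := Submodule.span ℝ (Set.range col)
  set W := Submodule.span ℝ (Set.range (col ∘ J)) with hW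
  let R : (Fin m → H) →ₗ[ℝ] (Fin p → H) := LinearMap.funLeft ℝ H I
  have : FiniteDimensional ℝ V := FiniteDimensional.span_of_finite ℝ (Set.finite_range _)
  have hWV : W ≤ V := Submodule.span_mono (Set.range_comp_subset_range J col)
  have hmap : Module.finrank ℝ (W.map R) = Module.finrank ℝ V := by
    rw [hW, Submodule.map_span, ← Set.range_comp]
    exact hrank
  have hWV' : W = V := Submodule.eq_of_le_of_finrank_map_eq R hWV hmap
  have hdisj : Disjoint V (LinearMap.ker R) :=
    Submodule.disjoint_ker_of_finrank_map_eq R (hWV' ▸ hmap)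
  have hj : col j ∈ V := Submodule.subset_span ⟨j, rfl⟩
  obtain ⟨x, hx⟩ := (Submodule.mem_span_range_iff_exists_fun ℝ).mp (hWV' ▸ hj : col j ∈ W)
  have hxA : ∀ k, ∑ t, x t • A k (J t) = A k j := fun k => by
    simpa [hcol, Finset.sum_apply] using congrFun hx k
  have hle := hc x
  simp only [hxA, sub_self, norm_zero] at hle
  have hzero : ∑ i' : Fin p, ‖(∑ t : Fin q, c t • A (I i') (J t)) - A (I i') j‖ ^ 2 = 0 := by
    refine le_antisymm (Real.sqrt_eq_zero'.mp (le_antisymm ?_ (Real.sqrt_nonneg _))) (by positivity)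
    simpa using hle
  rw [Finset.sum_eq_zero_iff_of_nonneg fun _ _ => by positivity] at hzero
  have hres : (∑ t, c t • col (J t)) - col j = 0 := by
    refine Submodule.disjoint_def.mp hdisj _ ?_ ?_
    · exact V.sub_mem (V.sum_mem fun t _ => V.smul_mem _ (Submodule.subset_span ⟨J t, rfl⟩)) hj
    · rw [LinearMap.mem_ker]
      funext i'
      simpa [R, LinearMap.funLeft_apply, hcol, Finset.sum_apply] using hzero i' (Finset.mem_univ _)
  have := congrFun (sub_eq_zero.mp hres) i
  simpa [hcol, Finset.sum_apply] using this.symm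
end

section
/- Let A be a function-valued tensor of size n over H and suppose A equals the Tucker product of a core tensor G of size r with factor matrices F k : Matrix (Fin (n k)) (Fin (r k)) ℝ, i.e., A i = Σ over j : (Π k : Fin d, Fin (r k)) of (Π_{k : Fin d} F k (i k) (j k)) • G j for every multi-index i. Then for every k : Fin d, the mode-k rank of A is at most the mode-k rank of G (componentwise inequality of Tucker ranks). -/
/-- The mode-`k` rank of a function-valued tensor `A : (Π l, Fin (n l)) → H`: the dimension
of the span of its mode-`k` slices in `(Π l, Fin (n l)) → H`. -/
noncomputable def modeRank {H : Type*} [NormedAddCommGroup H] [InnerProductSpace ℝ H]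
    {d : ℕ} {n : Fin d → ℕ} (A : (∀ k : Fin d, Fin (n k)) → H) (k : Fin d) : ℕ :=
  Module.finrank ℝ (Submodule.span ℝ (Set.range fun a : Fin (n k) =>
    fun i : ∀ l : Fin d, Fin (n l) => A (Function.update i k a)))

/-- Averaging over one coordinate: summing `f (Function.update j k b)` over all `b` and `j` counts
every value of `f` exactly `card (α k)` times. -/
lemma sum_sum_update {ι : Type*} [Fintype ι] [DecidableEq ι] {α : ι → Type*}
    [∀ l, Fintype (α l)] {M : Type*} [AddCommMonoid M] (k : ι) (f : (∀ l, α l) → M) :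
    ∑ b : α k, ∑ j : ∀ l, α l, f (Function.update j k b) = Fintype.card (α k) • ∑ j, f j := by
  have hinv : Function.Involutive
      fun p : α k × (∀ l, α l) => (p.2 k, Function.update p.2 k p.1) := by
    rintro ⟨b, j⟩
    simp
  rw [← Fintype.sum_prod_type' fun b j => f (Function.update j k b)]
  refine (Equiv.sum_comp hinv.toPerm fun p : α k × (∀ l, α l) => f p.2).trans ?_
  simp [Fintype.sum_prod_type]

/-- The Tucker product along all modes except `k`, averaged over the mode-`k` index. -/
noncomputable def tuckerErase {H : Type*} [NormedAddCommGroup H] [InnerProductSpace ℝ H]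
    {d : ℕ} {n r : Fin d → ℕ} (F : ∀ k : Fin d, Matrix (Fin (n k)) (Fin (r k)) ℝ) (k : Fin d) :
    ((∀ l : Fin d, Fin (r l)) → H) →ₗ[ℝ] ((∀ l : Fin d, Fin (n l)) → H) where
  toFun X i := (r k : ℝ)⁻¹ • ∑ j, (∏ l ∈ Finset.univ.erase k, F l (i l) (j l)) • X j
  map_add' X Y := by
    ext i
    simp [Finset.sum_add_distrib]
  map_smul' c X := by
    ext i
    simp only [Pi.smul_apply, RingHom.id_apply, Finset.smul_sum]
    refine Finset.sum_congr rfl fun j _ => ?_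
    simp only [smul_smul]
    ring_nf

/-- Every mode-`k` slice of a Tucker product is a combination of the images under `tuckerErase` of
the mode-`k` slices of the core. -/
lemma tucker_slice_eq_sum {H : Type*} [NormedAddCommGroup H] [InnerProductSpace ℝ H]
    {d : ℕ} {n r : Fin d → ℕ} (G : (∀ k : Fin d, Fin (r k)) → H)
    (F : ∀ k : Fin d, Matrix (Fin (n k)) (Fin (r k)) ℝ) (k : Fin d) (a : Fin (n k)) :
    (fun i : ∀ l : Fin d, Fin (n l) =>
      ∑ j : ∀ l : Fin d, Fin (r l), (∏ l, F l (Function.update i k a l) (j l)) • G j) =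
    ∑ b, F k a b • tuckerErase F k fun j => G (Function.update j k b) := by
  ext i
  have hprod (j : ∀ l : Fin d, Fin (r l)) : ∏ l, F l (Function.update i k a l) (j l) =
      F k a (j k) * ∏ l ∈ Finset.univ.erase k, F l (i l) (j l) := by
    rw [← Finset.mul_prod_erase _ _ (Finset.mem_univ k), Function.update_self]
    congr 1
    refine Finset.prod_congr rfl fun l hl => ?_
    rw [Function.update_of_ne (Finset.ne_of_mem_erase hl)]
  have herase (b : Fin (r k)) (j : ∀ l : Fin d, Fin (r l)) :
      ∏ l ∈ Finset.univ.erase k, F l (i l) (Function.update j k b l) =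
        ∏ l ∈ Finset.univ.erase k, F l (i l) (j l) := by
    refine Finset.prod_congr rfl fun l hl => ?_
    rw [Function.update_of_ne (Finset.ne_of_mem_erase hl)]
  have hsum := sum_sum_update k fun j : ∀ l : Fin d, Fin (r l) =>
    (F k a (j k) * ∏ l ∈ Finset.univ.erase k, F l (i l) (j l)) • G j
  simp only [Function.update_self, herase, Fintype.card_fin] at hsum
  simp only [hprod, Finset.sum_apply, Pi.smul_apply, tuckerErase, LinearMap.coe_mk, AddHom.coe_mk]
  simp only [smul_comm _ (r k : ℝ)⁻¹, ← Finset.smul_sum]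
  simp only [Finset.smul_sum (r := F k a _), smul_smul, hsum]
  rcases Nat.eq_zero_or_pos (r k) with h0 | hpos
  · have : IsEmpty (∀ l : Fin d, Fin (r l)) := ⟨fun j => (h0 ▸ j k : Fin 0).elim0⟩
    simp
  · rw [← Nat.cast_smul_eq_nsmul ℝ, smul_smul, inv_mul_cancel₀ (by positivity), one_smul]

/-- **Tucker rank bound for Tucker decompositions of function-valued tensors.**
If `A` is the Tucker product of a core tensor `G` with factor matrices `F k`, then for
every mode `k`, the mode-`k` rank of `A` is at most the mode-`k` rank of `G`. -/
theorem tucker_modeRank_le {H : Type*} [NormedAddCommGroup H] [InnerProductSpace ℝ H]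
    {d : ℕ} {n r : Fin d → ℕ}
    (A : (∀ k : Fin d, Fin (n k)) → H) (G : (∀ k : Fin d, Fin (r k)) → H)
    (F : ∀ k : Fin d, Matrix (Fin (n k)) (Fin (r k)) ℝ)
    (hA : ∀ i : ∀ k : Fin d, Fin (n k),
      A i = ∑ j : ∀ k : Fin d, Fin (r k), (∏ k : Fin d, F k (i k) (j k)) • G j) :
    ∀ k : Fin d, modeRank A k ≤ modeRank G k := by
  intro k
  have hle : Submodule.span ℝ (Set.range fun a : Fin (n k) =>
      fun i : ∀ l : Fin d, Fin (n l) => A (Function.update i k a)) ≤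
      (Submodule.span ℝ (Set.range fun b : Fin (r k) =>
        fun j : ∀ l : Fin d, Fin (r l) => G (Function.update j k b))).map (tuckerErase F k) := by
    rw [Submodule.span_le]
    rintro _ ⟨a, rfl⟩
    simp only [hA, tucker_slice_eq_sum]
    exact Submodule.sum_mem _ fun b _ => Submodule.smul_mem _ _
      (Submodule.mem_map_of_mem (Submodule.subset_span ⟨b, rfl⟩))
  have : FiniteDimensional ℝ (Submodule.span ℝ (Set.range fun b : Fin (r k) =>
      fun j : ∀ l : Fin d, Fin (r l) => G (Function.update j k b))) :=
    FiniteDimensional.span_of_finite ℝ (Set.finite_range _)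
  exact (Submodule.finrank_mono hle).trans (Submodule.finrank_map_le _ _)
end

section
/- Let A be a function-valued tensor of size n over H and suppose A equals the Tucker product of a core tensor G of size r with factor matrices F k : Matrix (Fin (n k)) (Fin (r k)) ℝ, where in addition G is a subtensor of A: there exist injective maps I k : Fin (r k) → Fin (n k) such that G j = A (fun k => I k (j k)) for all j. Then for every k : Fin d, the mode-k rank of A equals the mode-k rank of G (the Tucker ranks coincide). -/
/-- If the image under a linear map of the span of a finite family `w` contains the family
`v`, then the span of `v` has dimension at most that of the span of `w`. -/
theorem finrank_span_range_le_of_mem_map {V W ι κ : Type*} [AddCommGroup V] [Module ℝ V]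
    [AddCommGroup W] [Module ℝ W] [Finite κ] (v : ι → V) (w : κ → W) (E : W →ₗ[ℝ] V)
    (h : ∀ a, v a ∈ (Submodule.span ℝ (Set.range w)).map E) :
    Module.finrank ℝ (Submodule.span ℝ (Set.range v)) ≤
      Module.finrank ℝ (Submodule.span ℝ (Set.range w)) := by
  have : FiniteDimensional ℝ (Submodule.span ℝ (Set.range w)) :=
    FiniteDimensional.span_of_finite ℝ (Set.finite_range w)
  refine le_trans (Submodule.finrank_mono (Submodule.span_le.2 ?_))
    (Submodule.finrank_map_le E _)
  rintro _ ⟨a, rfl⟩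
  exact h a

/-- The mode-`k` rank of a subtensor is at most that of the tensor. -/
theorem modeRank_subtensor_le {H : Type*} [NormedAddCommGroup H] [InnerProductSpace ℝ H]
    {d : ℕ} {n r : Fin d → ℕ} (A : (∀ k : Fin d, Fin (n k)) → H)
    (I : ∀ k : Fin d, Fin (r k) → Fin (n k)) (k : Fin d) :
    modeRank (fun j : ∀ k : Fin d, Fin (r k) => A fun l => I l (j l)) k ≤ modeRank A k := by
  refine finrank_span_range_le_of_mem_map _ _
    (LinearMap.funLeft ℝ H fun (j : ∀ l, Fin (r l)) l => I l (j l)) fun b => ?_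
  refine ⟨_, Submodule.subset_span ⟨I k b, rfl⟩, ?_⟩
  ext j
  simp only [LinearMap.funLeft_apply]
  congr 1
  ext l
  rcases eq_or_ne l k with rfl | hl <;> simp [*]

/-- The mode-`k` rank of a Tucker product is at most that of its core. -/
theorem modeRank_tuckerProduct_le {H : Type*} [NormedAddCommGroup H] [InnerProductSpace ℝ H]
    {d : ℕ} {n r : Fin d → ℕ} (G : (∀ k : Fin d, Fin (r k)) → H)
    (F : ∀ k : Fin d, Matrix (Fin (n k)) (Fin (r k)) ℝ) (k : Fin d) :
    modeRank (fun i : ∀ k : Fin d, Fin (n k) =>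
      ∑ j : ∀ k : Fin d, Fin (r k), (∏ k : Fin d, F k (i k) (j k)) • G j) k ≤ modeRank G k := by
  rcases isEmpty_or_nonempty (Fin (r k)) with hr | ⟨⟨b₀⟩⟩
  · have : IsEmpty (∀ k : Fin d, Fin (r k)) := ⟨fun j => hr.elim (j k)⟩
    refine finrank_span_range_le_of_mem_map _ _ 0 fun a => ?_
    convert Submodule.zero_mem _
    simp
  -- Contract all modes other than `k`; the coordinate `b₀` is irrelevant on mode-`k` slices.
  let e := Equiv.piSplitAt k fun l => Fin (r l)
  let E : ((∀ l, Fin (r l)) → H) →ₗ[ℝ] ((∀ l, Fin (n l)) → H) :=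
    LinearMap.pi fun i => ∑ j : ∀ l : {l // l ≠ k}, Fin (r l),
      (∏ l : {l // l ≠ k}, F l (i l) (j l)) • LinearMap.proj (e.symm (b₀, j))
  refine finrank_span_range_le_of_mem_map _ _ E fun a => ?_
  refine ⟨∑ b, F k a b • fun j => G (Function.update j k b), Submodule.sum_mem _ fun b _ =>
    Submodule.smul_mem _ _ (Submodule.subset_span ⟨b, rfl⟩), ?_⟩
  ext i
  have hupd (b : Fin (r k)) (j : ∀ l : {l // l ≠ k}, Fin (r l)) :
      Function.update (e.symm (b₀, j)) k b = e.symm (b, j) := by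
    ext l
    rcases eq_or_ne l k with rfl | hl <;> simp [e, *]
  have hprod (b : Fin (r k)) (j : ∀ l : {l // l ≠ k}, Fin (r l)) :
      ∏ l, F l (Function.update i k a l) (e.symm (b, j) l) =
        F k a b * ∏ l : {l // l ≠ k}, F l (i l) (j l) := by
    rw [Fintype.prod_eq_mul_prod_subtype_ne _ k]
    congr 1
    · simp [e]
    · refine Finset.prod_congr rfl fun l _ => ?_
      simp [e, l.2]
  beta_reduce
  rw [← e.symm.sum_comp, Fintype.sum_prod_type]
  simp only [hprod, map_sum, map_smul, E, LinearMap.pi_apply,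
    LinearMap.sum_apply, LinearMap.smul_apply, LinearMap.proj_apply, hupd, mul_smul,
    Finset.smul_sum]

/-- **Tucker ranks coincide for Tucker-cross decompositions.**
If `A` is the Tucker product of a core tensor `G` with factor matrices `F k`, and `G` is a
subtensor of `A` (given by injective index maps `I k`), then for every mode `k`, the
mode-`k` rank of `A` equals the mode-`k` rank of `G`. -/
theorem tuckerCross_modeRank_eq {H : Type*} [NormedAddCommGroup H] [InnerProductSpace ℝ H]
    {d : ℕ} {n r : Fin d → ℕ}
    (A : (∀ k : Fin d, Fin (n k)) → H) (G : (∀ k : Fin d, Fin (r k)) → H)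
    (F : ∀ k : Fin d, Matrix (Fin (n k)) (Fin (r k)) ℝ)
    (I : ∀ k : Fin d, Fin (r k) → Fin (n k))
    (hI : ∀ k : Fin d, Function.Injective (I k))
    (hG : ∀ j : ∀ k : Fin d, Fin (r k), G j = A (fun k => I k (j k)))
    (hA : ∀ i : ∀ k : Fin d, Fin (n k),
      A i = ∑ j : ∀ k : Fin d, Fin (r k), (∏ k : Fin d, F k (i k) (j k)) • G j) :
    ∀ k : Fin d, modeRank A k = modeRank G k := by
  intro k
  apply le_antisymm
  · rw [funext hA]
    exact modeRank_tuckerProduct_le G F k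
  · rw [funext hG]
    exact modeRank_subtensor_le A I k
end

section
/- Let A be a function-valued tensor of size n over H, and for each k : Fin d let r k be the mode-k rank of A. Then there exist injective maps I k : Fin (r k) → Fin (n k) and matrices F k : Matrix (Fin (n k)) (Fin (r k)) ℝ with Matrix.rank (F k) = r k (full column rank), such that A equals the Tucker product of the subtensor G (where G j = A (fun k => I k (j k))) with the factors F k: A i = Σ over j : (Π k, Fin (r k)) of (Π_k F k (i k) (j k)) • A (fun k => I k (j k)) for every multi-index i. (Existence of a minimal Tucker-cross decomposition.) -/
/-- A finite family of vectors contains a basis of its span; the coordinates of the whole family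
in that basis form a matrix of full column rank. -/
lemma exists_injective_matrix_eq_sum_smul {V ι : Type*} [AddCommGroup V] [Module ℝ V] [Fintype ι]
    {r : ℕ} (v : ι → V) (hr : Module.finrank ℝ (Submodule.span ℝ (Set.range v)) = r) :
    ∃ (I : Fin r → ι) (F : Matrix ι (Fin r) ℝ), Function.Injective I ∧ F.rank = r ∧
      ∀ a, v a = ∑ j, F a j • v (I j) := by
  classical
  obtain ⟨κ, c, hc, hspan, hli⟩ := exists_linearIndependent' ℝ v
  have : Fintype κ := Fintype.ofInjective c hc
  have hcard : Fintype.card κ = r := by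
    rw [← hr, ← hspan, finrank_span_eq_card hli]
  let e : Fin r ≃ κ := (Fintype.equivFinOfCardEq hcard).symm
  have hmem : ∀ a, ∃ f : Fin r → ℝ, ∑ j, f j • v (c (e j)) = v a := fun a ↦ by
    rw [← Submodule.mem_span_range_iff_exists_fun ℝ (v := fun j ↦ v (c (e j)))]
    have hrange : Set.range (fun j ↦ v (c (e j))) = Set.range (v ∘ c) :=
      e.surjective.range_comp (v ∘ c)
    rw [hrange, hspan]
    exact Submodule.subset_span ⟨a, rfl⟩
  choose F hF using hmem
  have hI : Function.Injective (fun j ↦ c (e j)) := hc.comp e.injective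
  have hli' : LinearIndependent ℝ (fun j ↦ v (c (e j))) := hli.comp e e.injective
  have hone : (Matrix.of F).submatrix (fun j ↦ c (e j)) (Equiv.refl _) = 1 := by
    ext j l
    have hzero := Fintype.linearIndependent_iff.mp hli'
      (fun l ↦ F (c (e j)) l - (1 : Matrix (Fin r) (Fin r) ℝ) j l)
      (by simp [sub_smul, Finset.sum_sub_distrib, hF, Matrix.one_apply]) l
    simpa [sub_eq_zero] using hzero
  refine ⟨fun j ↦ c (e j), Matrix.of F, hI, le_antisymm ?_ ?_, fun a ↦ (hF a).symm⟩
  · simpa using (Matrix.of F).rank_le_card_width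
  · have hle := (Matrix.of F).rank_submatrix_le (fun j ↦ c (e j)) (Equiv.refl (Fin r))
    rw [hone] at hle
    simpa using hle

/-- A multilinear map that is unchanged by precomposing each single argument with an endomorphism
is unchanged by precomposing all arguments simultaneously. -/
lemma MultilinearMap.apply_eq_of_forall_update {R ι N : Type*} {M : ι → Type*} [CommSemiring R]
    [Fintype ι] [DecidableEq ι] [∀ k, AddCommMonoid (M k)] [∀ k, Module R (M k)]
    [AddCommMonoid N] [Module R N] (T : MultilinearMap R M N) (P : ∀ k, M k → M k)
    (h : ∀ k x, T (Function.update x k (P k (x k))) = T x) (x : ∀ k, M k) :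
    T (fun k ↦ P k (x k)) = T x := by
  have key : ∀ s : Finset ι, T (s.piecewise (fun k ↦ P k (x k)) x) = T x := by
    intro s
    induction s using Finset.induction_on with
    | empty => simp
    | insert k s hk ih =>
      rw [Finset.piecewise_insert, ← ih, ← h k (s.piecewise _ x),
        Finset.piecewise_eq_of_notMem _ _ _ hk]
  simpa using key Finset.univ

/-- Interpolation formulas in each mode of a tensor combine into a Tucker product. -/
lemma eq_sum_prod_smul_of_forall_update {R ι N : Type*} {α β : ι → Type*} [CommSemiring R]
    [Fintype ι] [DecidableEq ι] [∀ k, Fintype (α k)] [∀ k, DecidableEq (α k)]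
    [∀ k, Fintype (β k)] [AddCommMonoid N] [Module R N] (A : (∀ k, α k) → N)
    (I : ∀ k, β k → α k) (F : ∀ k, Matrix (α k) (β k) R)
    (h : ∀ k i, A i = ∑ j, F k (i k) j • A (Function.update i k (I k j))) (i : ∀ k, α k) :
    A i = ∑ j : ∀ k, β k, (∏ k, F k (i k) (j k)) • A (fun k ↦ I k (j k)) := by
  let T : MultilinearMap R (fun k ↦ α k → R) N := ∑ i : ∀ k, α k,
    ((MultilinearMap.mkPiAlgebra R ι R).compLinearMap
      (fun k ↦ LinearMap.proj (i k))).smulRight (A i)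
  have hT : ∀ i : ∀ k, α k, T (fun k ↦ Pi.single (i k) 1) = A i := by
    intro i
    simp only [T, _root_.sum_apply, MultilinearMap.smulRight_apply,
      MultilinearMap.compLinearMap_apply, LinearMap.proj_apply, MultilinearMap.mkPiAlgebra_apply]
    rw [Finset.sum_eq_single i]
    · simp
    · intro b _ hb
      obtain ⟨k, hk⟩ := Function.ne_iff.mp hb
      rw [Finset.prod_eq_zero (Finset.mem_univ k) (Pi.single_eq_of_ne hk 1), zero_smul]
    · simp
  let P : ∀ k, (α k → R) →ₗ[R] (α k → R) := fun k ↦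
    (Pi.basisFun R (α k)).constr R (fun a ↦ ∑ j, F k a j • Pi.single (I k j) 1)
  have hP : ∀ k a, P k (Pi.single a 1) = ∑ j, F k a j • Pi.single (I k j) 1 := by
    intro k a
    rw [← Pi.basisFun_apply]
    exact (Pi.basisFun R (α k)).constr_basis R _ a
  have hTP : ∀ k x, T (Function.update x k (P k (x k))) = T x := by
    intro k x
    let Q : ∀ l, (α l → R) →ₗ[R] (α l → R) :=
      Function.update (fun _ ↦ LinearMap.id) k (P k)
    have hQ : ∀ x : ∀ l, α l → R,
        (fun l ↦ Q l (x l)) = Function.update x k (P k (x k)) := by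
      intro x
      ext1 l
      by_cases hl : l = k
      · subst hl; simp [Q]
      · simp [Q, hl]
    have hcomp : T.compLinearMap Q = T := by
      refine Module.Basis.ext_multilinear (fun l ↦ Pi.basisFun R (α l)) fun i ↦ ?_
      simp only [MultilinearMap.compLinearMap_apply, Pi.basisFun_apply]
      rw [hQ, hP, MultilinearMap.map_update_sum, hT, h k i]
      refine Finset.sum_congr rfl fun j _ ↦ ?_
      rw [MultilinearMap.map_update_smul, ← hT]
      congr 2
      ext1 l
      by_cases hl : l = k
      · subst hl; simp
      · simp [hl]
    rw [← hQ, ← MultilinearMap.compLinearMap_apply, hcomp]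
  rw [← hT i, ← T.apply_eq_of_forall_update (fun k ↦ P k) hTP]
  simp only [hP]
  rw [MultilinearMap.map_sum]
  refine Finset.sum_congr rfl fun j _ ↦ ?_
  rw [MultilinearMap.map_smul_univ, hT]

/-- **Existence of a minimal Tucker-cross decomposition.**
Every function-valued tensor `A` admits a Tucker-cross decomposition whose core is a
subtensor `G j = A (fun k => I k (j k))` of size equal to the Tucker rank of `A`, with
injective index maps `I k` and full-column-rank factors `F k`. -/
theorem exists_minimal_tuckerCross {H : Type*} [NormedAddCommGroup H] [InnerProductSpace ℝ H]
    {d : ℕ} {n : Fin d → ℕ} (A : (∀ k : Fin d, Fin (n k)) → H) :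
    ∃ I : ∀ k : Fin d, Fin (modeRank A k) → Fin (n k),
    ∃ F : ∀ k : Fin d, Matrix (Fin (n k)) (Fin (modeRank A k)) ℝ,
      (∀ k : Fin d, Function.Injective (I k)) ∧
      (∀ k : Fin d, (F k).rank = modeRank A k) ∧
      (∀ i : ∀ k : Fin d, Fin (n k),
        A i = ∑ j : ∀ k : Fin d, Fin (modeRank A k),
          (∏ k : Fin d, F k (i k) (j k)) • A (fun k => I k (j k))) := by
  choose I F hI hF hA using fun k ↦ exists_injective_matrix_eq_sum_smul
    (fun a : Fin (n k) ↦ fun i : ∀ l, Fin (n l) ↦ A (Function.update i k a))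
    (r := modeRank A k) rfl
  refine ⟨I, F, hI, hF, eq_sum_prod_smul_of_forall_update A I F fun k i ↦ ?_⟩
  simpa using congrFun (hA k (i k)) i
end

section
/- Let A be a function-valued tensor of size n over H, let I k : Fin (m k) → Fin (n k) be injective index maps, and let G be the subtensor G j = A (fun k => I k (j k)). If for every k : Fin d the mode-k rank of G equals the mode-k rank of A, then there exist matrices F k : Matrix (Fin (n k)) (Fin (m k)) ℝ such that A equals the Tucker product of G with the factors F k: A i = Σ over j : (Π k, Fin (m k)) of (Π_k F k (i k) (j k)) • G j for every multi-index i. (Cross interpolation from a Tucker-rank-preserving subtensor is exact.) -/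
section TuckerCross

variable {H : Type*} [NormedAddCommGroup H] [InnerProductSpace ℝ H]
  {d : ℕ} {n m : Fin d → ℕ}

/-- If a subtensor has the same mode-`k` rank as the whole tensor, then the mode-`k` slices at
the selected indices span all mode-`k` slices. -/
lemma exists_slice_eq_sum_of_modeRank_eq (A : (∀ k : Fin d, Fin (n k)) → H)
    (I : ∀ k : Fin d, Fin (m k) → Fin (n k)) (k : Fin d)
    (hrank : modeRank (fun j : ∀ k : Fin d, Fin (m k) => A fun k => I k (j k)) k = modeRank A k) :
    ∃ F : Matrix (Fin (n k)) (Fin (m k)) ℝ, ∀ i : ∀ l : Fin d, Fin (n l),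
      A i = ∑ b, F (i k) b • A (Function.update i k (I k b)) := by
  let slice : Fin (n k) → (∀ l : Fin d, Fin (n l)) → H := fun a i => A (Function.update i k a)
  let S := Submodule.span ℝ (Set.range slice)
  let T := Submodule.span ℝ (Set.range (slice ∘ I k))
  let restrict : ((∀ l : Fin d, Fin (n l)) → H) →ₗ[ℝ] ((∀ l : Fin d, Fin (m l)) → H) :=
    LinearMap.funLeft ℝ H fun j l => I l (j l)
  have : FiniteDimensional ℝ S := FiniteDimensional.span_of_finite ℝ (Set.finite_range _)
  have : FiniteDimensional ℝ T := FiniteDimensional.span_of_finite ℝ (Set.finite_range _)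
  have hTS : T ≤ S := Submodule.span_mono (Set.range_comp_subset_range _ _)
  have hmap : T.map restrict = Submodule.span ℝ (Set.range fun (b : Fin (m k))
      (j : ∀ l : Fin d, Fin (m l)) => A fun l => I l (Function.update j k b l)) := by
    rw [Submodule.map_span, ← Set.range_comp]
    congr 2
    funext b j
    change A (Function.update (fun l => I l (j l)) k (I k b)) = _
    congr 1
    funext l
    exact (Function.apply_update (fun l => I l) j k b l).symm
  have hle : Module.finrank ℝ S ≤ Module.finrank ℝ T := by
    change modeRank A k ≤ _
    rw [← hrank, modeRank, ← hmap]
    exact Submodule.finrank_map_le restrict T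
  have hEq : T = S := Submodule.eq_of_le_of_finrank_le hTS hle
  have hmem (a : Fin (n k)) : ∃ c : Fin (m k) → ℝ, ∑ b, c b • slice (I k b) = slice a := by
    have ha : slice a ∈ T := hEq ▸ Submodule.subset_span (Set.mem_range_self a)
    exact (Submodule.mem_span_range_iff_exists_fun ℝ).1 ha
  choose F hF using hmem
  refine ⟨F, fun i => ?_⟩
  simpa [slice] using (congrFun (hF (i k)) i).symm

/-- The multilinear map whose values on tuples of standard basis vectors are the entries of `A`. -/
noncomputable def tensorMultilinear (A : (∀ k : Fin d, Fin (n k)) → H) :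
    MultilinearMap ℝ (fun k : Fin d => Fin (n k) → ℝ) H :=
  ∑ i, ((MultilinearMap.mkPiAlgebra ℝ (Fin d) ℝ).compLinearMap
    fun k => LinearMap.proj (i k)).smulRight (A i)

lemma tensorMultilinear_single (A : (∀ k : Fin d, Fin (n k)) → H) (i : ∀ k : Fin d, Fin (n k)) :
    tensorMultilinear A (fun k => Pi.single (i k) 1) = A i := by
  rw [tensorMultilinear, sum_apply, Finset.sum_eq_single i]
  · simp
  · intro j _ hj
    obtain ⟨k, hk⟩ := Function.ne_iff.1 hj
    have : ∏ k, (Pi.single (i k) 1 : Fin (n k) → ℝ) (j k) = 0 :=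
      Finset.prod_eq_zero (Finset.mem_univ k) (Pi.single_eq_of_ne hk 1)
    simp [this]
  · simp

/-- A multilinear map that is invariant under applying `L k` to its `k`-th argument, for each `k`
separately, is invariant under applying all the `L k` simultaneously. -/
lemma MultilinearMap.map_apply_of_map_update {ι R N : Type*} [Fintype ι] [DecidableEq ι]
    [Semiring R] {M : ι → Type*} [∀ k, AddCommMonoid (M k)] [∀ k, Module R (M k)]
    [AddCommMonoid N] [Module R N] (Φ : MultilinearMap R M N) (L : ∀ k, M k → M k)
    (h : ∀ k x, Φ (Function.update x k (L k (x k))) = Φ x) (x : ∀ k, M k) :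
    Φ (fun k => L k (x k)) = Φ x := by
  have key (s : Finset ι) : Φ (s.piecewise (fun k => L k (x k)) x) = Φ x := by
    induction s using Finset.induction_on with
    | empty => simp
    | insert k s hk ih =>
      have hs := h k (s.piecewise (fun k => L k (x k)) x)
      rw [Finset.piecewise_eq_of_notMem _ _ _ hk] at hs
      rw [Finset.piecewise_insert, hs, ih]
  simpa using key Finset.univ

/-- Mode-wise expansions in the selected slices combine to a Tucker decomposition. -/
lemma eq_tucker_of_slice_eq_sum (A : (∀ k : Fin d, Fin (n k)) → H)
    (I : ∀ k : Fin d, Fin (m k) → Fin (n k)) (F : ∀ k, Matrix (Fin (n k)) (Fin (m k)) ℝ)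
    (hF : ∀ k i, A i = ∑ b, F k (i k) b • A (Function.update i k (I k b)))
    (i : ∀ k : Fin d, Fin (n k)) :
    A i = ∑ j : ∀ k : Fin d, Fin (m k), (∏ k, F k (i k) (j k)) • A fun k => I k (j k) := by
  let Φ := tensorMultilinear A
  let L (k : Fin d) : (Fin (n k) → ℝ) →ₗ[ℝ] (Fin (n k) → ℝ) :=
    (Pi.basisFun ℝ (Fin (n k))).constr ℝ fun a => ∑ b, F k a b • Pi.single (I k b) 1
  have hL (k : Fin d) (a : Fin (n k)) :
      L k (Pi.single a 1) = ∑ b, F k a b • Pi.single (I k b) 1 := by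
    rw [← Pi.basisFun_apply ℝ (Fin (n k)) a]
    exact Module.Basis.constr_basis _ _ _ _
  have hupdate (k : Fin d) (x : ∀ l, Fin (n l) → ℝ) :
      Φ (Function.update x k (L k (x k))) = Φ x := by
    have hcomp (x : ∀ l, Fin (n l) → ℝ) :
        (fun l => Function.update (fun l => (LinearMap.id : (Fin (n l) → ℝ) →ₗ[ℝ] _)) k (L k) l
          (x l)) = Function.update x k (L k (x k)) := by
      funext l
      obtain rfl | hl := eq_or_ne l k <;> simp [*]
    have hΦ : Φ.compLinearMap (Function.update (fun _ => LinearMap.id) k (L k)) = Φ := by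
      refine Module.Basis.ext_multilinear (fun l => Pi.basisFun ℝ (Fin (n l))) fun v => ?_
      have hsingle (b : Fin (m k)) :
          Function.update (fun l => (Pi.single (v l) 1 : Fin (n l) → ℝ)) k (Pi.single (I k b) 1) =
            fun l => Pi.single (Function.update v k (I k b) l) 1 := by
        funext l
        exact (Function.apply_update (fun l a => (Pi.single a 1 : Fin (n l) → ℝ)) v k _ l).symm
      simp only [MultilinearMap.compLinearMap_apply, Pi.basisFun_apply]
      rw [hcomp, hL, MultilinearMap.map_update_sum]
      simp only [MultilinearMap.map_update_smul, hsingle, Φ, tensorMultilinear_single]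
      exact (hF k v).symm
    rw [← hcomp, ← MultilinearMap.compLinearMap_apply, hΦ]
  calc
    A i = Φ fun k => Pi.single (i k) 1 := (tensorMultilinear_single A i).symm
    _ = Φ fun k => ∑ b, F k (i k) b • Pi.single (I k b) 1 := by
      rw [← Φ.map_apply_of_map_update (fun k => L k) hupdate]
      simp only [hL]
    _ = _ := by
      rw [MultilinearMap.map_sum]
      simp only [MultilinearMap.map_smul_univ, Φ, tensorMultilinear_single]

end TuckerCross

/-- **Cross interpolation from a Tucker-rank-preserving subtensor is exact.**
If the subtensor `G j = A (fun k => I k (j k))` of a function-valued tensor `A` has the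
same Tucker rank as `A` (for every mode), then `A` is exactly the Tucker product of `G`
with suitable factor matrices `F k`. -/
theorem tuckerCross_exact_of_rank_eq {H : Type*} [NormedAddCommGroup H] [InnerProductSpace ℝ H]
    {d : ℕ} {n m : Fin d → ℕ} (A : (∀ k : Fin d, Fin (n k)) → H)
    (I : ∀ k : Fin d, Fin (m k) → Fin (n k))
    (hI : ∀ k : Fin d, Function.Injective (I k))
    (G : (∀ k : Fin d, Fin (m k)) → H)
    (hG : ∀ j : ∀ k : Fin d, Fin (m k), G j = A (fun k => I k (j k)))
    (hrank : ∀ k : Fin d, modeRank G k = modeRank A k) :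
    ∃ F : ∀ k : Fin d, Matrix (Fin (n k)) (Fin (m k)) ℝ,
      ∀ i : ∀ k : Fin d, Fin (n k),
        A i = ∑ j : ∀ k : Fin d, Fin (m k), (∏ k : Fin d, F k (i k) (j k)) • G j := by
  obtain rfl : G = fun j => A fun k => I k (j k) := funext hG
  choose F hF using fun k => exists_slice_eq_sum_of_modeRank_eq A I k (hrank k)
  exact ⟨F, eq_tucker_of_slice_eq_sum A I F hF⟩
end

section
/- Let A be a function-valued tensor of size n over H, let I k : Fin (m k) → Fin (n k) be injective index maps (with m k ≥ 1), let G be the subtensor G j = A (fun k => I k (j k)), and let B be any Tucker-cross approximation of A at (I₁,…,I_d). Fix k : Fin d. Then B interpolates all restricted mode-k fibers of A, i.e., B (Function.update (fun l => I l (j l)) k i) = A (Function.update (fun l => I l (j l)) k i) for all i : Fin (n k) and all j : (Π l, Fin (m l)), if and only if the dimension of the linear span of the mode-k slices of G equals the dimension of the linear span of the set of restricted mode-k fibers {R_k(i) | i : Fin (n k)}. -/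
/-- The `ℓ2(H)`-norm of a finitely indexed family of elements of `H`. -/
noncomputable def l2Norm {H : Type*} [NormedAddCommGroup H] {S : Type*} [Fintype S]
    (v : S → H) : ℝ :=
  Real.sqrt (∑ s : S, ‖v s‖ ^ 2)

/-- `B` is a Tucker-cross approximation of the function-valued tensor `A` at the index maps
`I k : Fin (m k) → Fin (n k)`: `B` is the Tucker product of the subtensor
`G j = A (fun l => I l (j l))` with factor matrices `F k` each of whose rows is a
least-squares minimizer, in the `ℓ2(H)`-norm, fitting the corresponding restricted
mode-`k` fiber of `A`. -/
def IsTuckerCrossApprox {H : Type*} [NormedAddCommGroup H] [InnerProductSpace ℝ H]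
    {d : ℕ} {n m : Fin d → ℕ} (A : (∀ k : Fin d, Fin (n k)) → H)
    (I : ∀ k : Fin d, Fin (m k) → Fin (n k)) (B : (∀ k : Fin d, Fin (n k)) → H) : Prop :=
  ∃ F : ∀ k : Fin d, Matrix (Fin (n k)) (Fin (m k)) ℝ,
    (∀ (k : Fin d) (i : Fin (n k)) (x : Fin (m k) → ℝ),
      l2Norm (fun j : ∀ l : Fin d, Fin (m l) =>
          (∑ b : Fin (m k), F k i b • A (fun l => I l (Function.update j k b l))) -
            A (Function.update (fun l => I l (j l)) k i)) ≤
      l2Norm (fun j : ∀ l : Fin d, Fin (m l) =>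
          (∑ b : Fin (m k), x b • A (fun l => I l (Function.update j k b l))) -
            A (Function.update (fun l => I l (j l)) k i))) ∧
    (∀ i : ∀ k : Fin d, Fin (n k),
      B i = ∑ j : ∀ l : Fin d, Fin (m l),
        (∏ k : Fin d, F k (i k) (j k)) • A (fun l => I l (j l)))

theorem l2Norm_eq_zero_iff {H : Type*} [NormedAddCommGroup H] {S : Type*} [Fintype S]
    {v : S → H} : l2Norm v = 0 ↔ ∀ s, v s = 0 := by
  rw [l2Norm, Real.sqrt_eq_zero (by positivity),
    Finset.sum_eq_zero_iff_of_nonneg (fun _ _ => by positivity)]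
  simp

/-- A least-squares fit is exact as soon as some exact fit exists. -/
theorem eq_of_forall_l2Norm_sub_le {H : Type*} [NormedAddCommGroup H] {S X : Type*} [Fintype S]
    {f : X → S → H} {r : S → H} {x y : X}
    (hmin : ∀ z, l2Norm (fun s => f x s - r s) ≤ l2Norm (fun s => f z s - r s))
    (hy : ∀ s, f y s = r s) (s : S) : f x s = r s := by
  have hzero : l2Norm (fun s => f y s - r s) = 0 :=
    l2Norm_eq_zero_iff.2 fun s => sub_eq_zero.2 (hy s)
  have hx : l2Norm (fun s => f x s - r s) = 0 :=
    le_antisymm (hzero ▸ hmin y) (Real.sqrt_nonneg _)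
  exact sub_eq_zero.1 (l2Norm_eq_zero_iff.1 hx s)

theorem piSplitAt_symm_eq_update {ι : Type*} [DecidableEq ι] {κ : ι → Type*} (k : ι) (b c : κ k)
    (p : ∀ l : {l // l ≠ k}, κ l) :
    (Equiv.piSplitAt k κ).symm (b, p) =
      Function.update ((Equiv.piSplitAt k κ).symm (c, p)) k b := by
  funext l
  by_cases hl : l = k
  · subst hl
    simp [Equiv.piSplitAt]
  · simp [Equiv.piSplitAt, hl]

section TuckerContraction

variable {ι M : Type*} [Fintype ι] [DecidableEq ι] {κ : ι → Type*} [∀ l, Fintype (κ l)]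
  [AddCommGroup M] [Module ℝ M]

/-- The contraction of a tensor `G` with one vector in every mode. -/
def tuckerContract (G : (∀ l, κ l) → M) (w : ∀ l, κ l → ℝ) : M :=
  ∑ j, (∏ l, w l (j l)) • G j

/-- Contracting all modes amounts to contracting mode `k` first. -/
theorem tuckerContract_eq_sum_split (G : (∀ l, κ l) → M) (w : ∀ l, κ l → ℝ) (k : ι) :
    tuckerContract G w = ∑ p : ∀ l : {l // l ≠ k}, κ l, (∏ l : {l // l ≠ k}, w l (p l)) •
      ∑ b, w k b • G ((Equiv.piSplitAt k κ).symm (b, p)) := by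
  rw [tuckerContract, ← (Equiv.piSplitAt k κ).symm.sum_comp, Fintype.sum_prod_type_right]
  refine Finset.sum_congr rfl fun p _ => ?_
  rw [Finset.smul_sum]
  refine Finset.sum_congr rfl fun b _ => ?_
  rw [smul_smul, Fintype.prod_eq_mul_prod_subtype_ne _ k, mul_comm]
  congr 2
  · exact Finset.prod_congr rfl fun l _ => by simp [Equiv.piSplitAt, l.2]
  · simp [Equiv.piSplitAt]

theorem tuckerContract_congr_mode [∀ l, Nonempty (κ l)] (G : (∀ l, κ l) → M)
    {v w : ∀ l, κ l → ℝ} (k : ι) (hne : ∀ l, l ≠ k → v l = w l)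
    (hk : ∀ j, ∑ b, v k b • G (Function.update j k b) = ∑ b, w k b • G (Function.update j k b)) :
    tuckerContract G v = tuckerContract G w := by
  rw [tuckerContract_eq_sum_split G v k, tuckerContract_eq_sum_split G w k]
  refine Finset.sum_congr rfl fun p _ => ?_
  congr 1
  · exact Finset.prod_congr rfl fun l _ => by rw [hne l l.2]
  · simpa only [← piSplitAt_symm_eq_update] using
      hk ((Equiv.piSplitAt k κ).symm (Classical.arbitrary _, p))

theorem tuckerContract_congr [∀ l, Nonempty (κ l)] (G : (∀ l, κ l) → M)
    {v w : ∀ l, κ l → ℝ}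
    (h : ∀ k j, ∑ b, v k b • G (Function.update j k b) =
      ∑ b, w k b • G (Function.update j k b)) :
    tuckerContract G v = tuckerContract G w := by
  have hs (s : Finset ι) : tuckerContract G v = tuckerContract G (s.piecewise w v) := by
    induction s using Finset.induction_on with
    | empty => simp
    | insert k s hk ih =>
      rw [ih]
      refine tuckerContract_congr_mode G k (fun l hl => ?_) fun j => ?_
      · simp [Finset.piecewise, hl]
      · simpa [hk] using h k j
  simpa using hs Finset.univ

theorem tuckerContract_update_single [∀ l, DecidableEq (κ l)] (G : (∀ l, κ l) → M)
    (j : ∀ l, κ l) (k : ι) (x : κ k → ℝ) :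
    tuckerContract G (Function.update (fun l => Pi.single (j l) 1) k x) =
      ∑ b, x b • G (Function.update j k b) := by
  rw [tuckerContract_eq_sum_split G _ k,
    Finset.sum_eq_single fun l : {l // l ≠ k} => j l]
  · have hj (b : κ k) : (Equiv.piSplitAt k κ).symm (b, fun l => j l) = Function.update j k b := by
      rw [piSplitAt_symm_eq_update k b (j k)]
      exact congrArg (Function.update · k b) ((Equiv.piSplitAt k κ).symm_apply_apply j)
    rw [Finset.prod_eq_one fun l _ => by simp [Function.update_of_ne l.2]]
    simp [hj]
  · intro p _ hp
    obtain ⟨l, hl⟩ := Function.ne_iff.1 hp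
    rw [Finset.prod_eq_zero (Finset.mem_univ l) (by simp [Function.update_of_ne l.2, hl]),
      zero_smul]
  · simp

/-- If the weights select the index `j l` in every mode `l ≠ k`, only mode `k` is contracted. -/
theorem tuckerContract_eq_sum_update [∀ l, Nonempty (κ l)] (G : (∀ l, κ l) → M)
    {w : ∀ l, κ l → ℝ} (j : ∀ l, κ l) (k : ι)
    (h : ∀ l, l ≠ k → ∀ j', ∑ b, w l b • G (Function.update j' l b) =
      G (Function.update j' l (j l))) :
    tuckerContract G w = ∑ b, w k b • G (Function.update j k b) := by
  classical
  rw [← tuckerContract_update_single]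
  refine tuckerContract_congr G fun l j' => ?_
  by_cases hl : l = k
  · subst hl
    simp
  · rw [h l hl, Function.update_of_ne hl, Finset.sum_eq_single (j l)] <;> simp +contextual

end TuckerContraction

/-- Restricting the mode-`k` fiber to a selected index gives a slice of the subtensor. -/
theorem update_comp_index {d : ℕ} {n m : Fin d → ℕ} (I : ∀ k : Fin d, Fin (m k) → Fin (n k))
    (j : ∀ l, Fin (m l)) (k : Fin d) (b : Fin (m k)) :
    (fun l => I l (Function.update j k b l)) =
      Function.update (fun l => I l (j l)) k (I k b) := by
  funext l
  exact Function.apply_update I j k b l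

/-- **Fiber interpolation criterion for Tucker-cross approximations.**
Let `B` be a Tucker-cross approximation of `A` at injective index maps `I k` (with
`m k ≥ 1`) and fix a mode `k`. Then `B` interpolates all restricted mode-`k` fibers of `A`
if and only if the mode-`k` rank of the subtensor `G` equals the dimension of the span of
the restricted mode-`k` fibers of `A`. -/
theorem tuckerCrossApprox_fiber_interp_iff {H : Type*} [NormedAddCommGroup H]
    [InnerProductSpace ℝ H] {d : ℕ} {n m : Fin d → ℕ}
    (A : (∀ k : Fin d, Fin (n k)) → H)
    (I : ∀ k : Fin d, Fin (m k) → Fin (n k))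
    (hm : ∀ k : Fin d, 1 ≤ m k)
    (hI : ∀ k : Fin d, Function.Injective (I k))
    (G : (∀ k : Fin d, Fin (m k)) → H)
    (hG : ∀ j : ∀ k : Fin d, Fin (m k), G j = A (fun k => I k (j k)))
    (B : (∀ k : Fin d, Fin (n k)) → H)
    (hB : IsTuckerCrossApprox A I B) (k : Fin d) :
    (∀ (i : Fin (n k)) (j : ∀ l : Fin d, Fin (m l)),
        B (Function.update (fun l => I l (j l)) k i) =
          A (Function.update (fun l => I l (j l)) k i)) ↔
    modeRank G k = Module.finrank ℝ (Submodule.span ℝ (Set.range fun i : Fin (n k) =>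
        fun j : ∀ l : Fin d, Fin (m l) => A (Function.update (fun l => I l (j l)) k i))) := by
  obtain rfl : G = fun j => A (fun l => I l (j l)) := funext hG
  obtain ⟨F, hF, hBF⟩ := hB
  have (l : Fin d) : Nonempty (Fin (m l)) := ⟨⟨0, hm l⟩⟩
  set G : (∀ l, Fin (m l)) → H := fun j => A (fun l => I l (j l)) with hGdef
  have hselect (l : Fin d) (a : Fin (m l)) (j : ∀ l, Fin (m l)) :
      ∑ b, F l (I l a) b • G (Function.update j l b) = G (Function.update j l a) := by
    have := eq_of_forall_l2Norm_sub_le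
      (f := fun (x : Fin (m l) → ℝ) j => ∑ b, x b • G (Function.update j l b))
      (y := Pi.single a 1) (hF l (I l a)) (fun j => by
        rw [← update_comp_index, Finset.sum_eq_single a] <;> simp +contextual [hGdef]) j
    rwa [← update_comp_index] at this
  have hBeq (i : Fin (n k)) (j : ∀ l, Fin (m l)) :
      B (Function.update (fun l => I l (j l)) k i) =
        ∑ b, F k i b • G (Function.update j k b) := by
    have := tuckerContract_eq_sum_update G
      (w := fun l => F l (Function.update (fun l => I l (j l)) k i l)) j k (fun l hl j' => by
        simpa only [Function.update_of_ne hl] using hselect l (j l) j')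
    rw [Function.update_self] at this
    rw [hBF, ← this, tuckerContract]
  set S : Fin (m k) → (∀ l, Fin (m l)) → H := fun b j => G (Function.update j k b) with hS
  set R : Fin (n k) → (∀ l, Fin (m l)) → H :=
    fun i j => A (Function.update (fun l => I l (j l)) k i) with hR
  have hSR : Submodule.span ℝ (Set.range S) ≤ Submodule.span ℝ (Set.range R) := by
    refine Submodule.span_mono ?_
    rintro _ ⟨b, rfl⟩
    exact ⟨I k b, funext fun j => by simp only [hR, hS, hGdef, update_comp_index]⟩
  have hfin : FiniteDimensional ℝ (Submodule.span ℝ (Set.range R)) :=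
    FiniteDimensional.span_of_finite ℝ (Set.finite_range R)
  constructor
  · intro h
    have hRS : Submodule.span ℝ (Set.range R) ≤ Submodule.span ℝ (Set.range S) := by
      rw [Submodule.span_le]
      rintro _ ⟨i, rfl⟩
      refine (Submodule.mem_span_range_iff_exists_fun ℝ).2 ⟨F k i, funext fun j => ?_⟩
      simpa [hS, hR] using (hBeq i j).symm.trans (h i j)
    exact congrArg (fun W : Submodule ℝ ((∀ l, Fin (m l)) → H) => Module.finrank ℝ W)
      (le_antisymm hSR hRS)
  · intro h i j
    have hi : R i ∈ Submodule.span ℝ (Set.range S) := by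
      rw [Submodule.eq_of_le_of_finrank_eq hSR h]
      exact Submodule.subset_span ⟨i, rfl⟩
    obtain ⟨x, hx⟩ := (Submodule.mem_span_range_iff_exists_fun ℝ).1 hi
    rw [hBeq]
    exact eq_of_forall_l2Norm_sub_le
      (f := fun (x : Fin (m k) → ℝ) j => ∑ b, x b • G (Function.update j k b))
      (y := x) (hF k i) (fun j => by simpa [hS, hR] using congrFun hx j) j
end

section
/- Let H be a real Hilbert space, let A be a function-valued tensor of size n over H, and let r : Fin d → ℕ satisfy r k ≤ mode-k rank of A for every k. Then there exists a function-valued tensor B of size n with mode-k rank of B at most r k for every k, such that for EVERY function-valued tensor C of size n with mode-k rank of C at most r k for every k, one has ‖A − B‖_{ℓ2(H)} ≤ √d · ‖A − C‖_{ℓ2(H)}. (Quasi-optimality of the truncated higher-order SVD for function-valued tensors.) -/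
/-- The trace of an idempotent matrix is its rank. -/
theorem trace_eq_rank_of_isIdempotentElem {ι : Type*} [Fintype ι] [DecidableEq ι]
    {P : Matrix ι ι ℝ} (hP : IsIdempotentElem P) : P.trace = P.rank := by
  have h : IsIdempotentElem (Matrix.toLin' P) := by
    rw [IsIdempotentElem, Module.End.mul_eq_comp, ← Matrix.toLin'_mul, hP.eq]
  rw [← Matrix.trace_toLin'_eq, (LinearMap.IsIdempotentElem.isProj_range _ h).trace]
  rfl

/-- Combining a family with the rows of an idempotent matrix gives a family spanning a space of
dimension at most the trace of that matrix. -/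
theorem finrank_span_sum_smul_le_trace {ι M : Type*} [Fintype ι] [DecidableEq ι] [AddCommGroup M]
    [Module ℝ M] {P : Matrix ι ι ℝ} (hP : IsIdempotentElem P) (v : ι → M) :
    (Module.finrank ℝ (Submodule.span ℝ (Set.range fun a => ∑ b, P a b • v b)) : ℝ) ≤ P.trace := by
  rw [trace_eq_rank_of_isIdempotentElem hP, P.rank_eq_finrank_span_row]
  have h : Submodule.span ℝ (Set.range fun a => ∑ b, P a b • v b) =
      (Submodule.span ℝ (Set.range P.row)).map (Fintype.linearCombination ℝ v) := by
    rw [Submodule.map_span, ← Set.range_comp]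
    rfl
  rw [h]
  exact_mod_cast Submodule.finrank_map_le _ _

/-- A finite family is reproduced by some orthogonal projection matrix whose trace is the dimension
of the span of the family. -/
theorem exists_isSymm_isIdempotentElem_sum_smul_eq {ι M : Type*} [Fintype ι] [DecidableEq ι]
    [AddCommGroup M] [Module ℝ M] (v : ι → M) :
    ∃ Q : Matrix ι ι ℝ, Q.IsSymm ∧ IsIdempotentElem Q ∧
      Q.trace = Module.finrank ℝ (Submodule.span ℝ (Set.range v)) ∧
      ∀ a, ∑ b, Q a b • v b = v a := by
  let L : EuclideanSpace ℝ ι →ₗ[ℝ] M :=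
    Fintype.linearCombination ℝ v ∘ₗ (WithLp.linearEquiv 2 ℝ (ι → ℝ)).toLinearMap
  let T : EuclideanSpace ℝ ι →ₗ[ℝ] EuclideanSpace ℝ ι := (LinearMap.ker L)ᗮ.starProjection
  let e := (EuclideanSpace.basisFun ι ℝ).toBasis
  have hLrange : LinearMap.range L = Submodule.span ℝ (Set.range v) := by
    rw [LinearMap.range_comp_of_range_eq_top _ (LinearEquiv.range _),
      Fintype.range_linearCombination]
  have hT : LinearMap.IsSymmetric T := Submodule.starProjection_isSymmetric _
  have hTT : IsIdempotentElem T :=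
    ContinuousLinearMap.IsIdempotentElem.toLinearMap (Submodule.isIdempotentElem_starProjection _)
  have hLT : ∀ x, L (T x) = L x := fun x => by
    have : x - T x ∈ LinearMap.ker L := by
      have := Submodule.sub_starProjection_mem_orthogonal (K := (LinearMap.ker L)ᗮ) x
      rwa [Submodule.orthogonal_orthogonal] at this
    rw [LinearMap.mem_ker, map_sub, sub_eq_zero] at this
    exact this.symm
  have happly : ∀ a b, LinearMap.toMatrix e e T a b = T (EuclideanSpace.single b 1) a := by
    intro a b
    simp [e, LinearMap.toMatrix_apply]
  have hsymm : (LinearMap.toMatrix e e T).IsSymm := by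
    ext a b
    have := hT (EuclideanSpace.single a 1) (EuclideanSpace.single b 1)
    simpa [happly, EuclideanSpace.inner_single_left, EuclideanSpace.inner_single_right] using this
  refine ⟨LinearMap.toMatrix e e T, hsymm, ?_, ?_, fun a => ?_⟩
  · rw [IsIdempotentElem, ← LinearMap.toMatrix_mul, hTT.eq]
  · rw [← LinearMap.trace_eq_matrix_trace, (LinearMap.IsIdempotentElem.isProj_range _ hTT).trace,
      ← hLrange]
    have h₁ := L.finrank_range_add_finrank_ker
    have h₂ := Submodule.finrank_add_finrank_orthogonal (LinearMap.ker L)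
    have h₃ : LinearMap.range T = (LinearMap.ker L)ᗮ := Submodule.range_starProjection _
    rw [h₃]
    norm_cast
    omega
  · have h := hLT (EuclideanSpace.single a 1)
    simp only [← hsymm.apply a, happly]
    simpa [L, Fintype.linearCombination_apply, Pi.single_apply] using h

/-- The symmetric idempotent matrices of trace at most `r` form a compact set. -/
theorem isCompact_setOf_isSymm_isIdempotentElem_trace_le (ι : Type*) [Fintype ι] (r : ℝ) :
    IsCompact {P : Matrix ι ι ℝ | P.IsSymm ∧ IsIdempotentElem P ∧ P.trace ≤ r} := by
  have hbox : IsCompact (Set.univ.pi fun _ : ι => Set.univ.pi fun _ : ι => Set.Icc (-1 : ℝ) 1) :=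
    isCompact_univ_pi fun _ => isCompact_univ_pi fun _ => isCompact_Icc
  refine hbox.of_isClosed_subset ?_ ?_
  · have hsymm : IsClosed {P : Matrix ι ι ℝ | P.IsSymm} :=
      isClosed_eq continuous_id.matrix_transpose continuous_id
    have hidem : IsClosed {P : Matrix ι ι ℝ | IsIdempotentElem P} :=
      isClosed_eq (continuous_id.matrix_mul continuous_id) continuous_id
    have htrace : IsClosed {P : Matrix ι ι ℝ | P.trace ≤ r} :=
      isClosed_le continuous_id.matrix_trace continuous_const
    exact hsymm.inter (hidem.inter htrace)
  · rintro (P : Matrix ι ι ℝ) ⟨hs, hi, -⟩ a - b -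
    have hdiag : P a a = ∑ c, P a c ^ 2 := by
      conv_lhs => rw [← hi.eq, Matrix.mul_apply]
      exact Finset.sum_congr rfl fun c _ => by rw [hs.apply a c, sq]
    have hle : ∀ c, P a c ^ 2 ≤ P a a := fun c => by
      rw [hdiag]
      exact Finset.single_le_sum (f := fun c => P a c ^ 2) (fun _ _ => sq_nonneg _)
        (Finset.mem_univ c)
    have h₁ := hle a
    have h₂ := hle b
    exact abs_le.1 (abs_le_one_iff_mul_self_le_one.2 (by nlinarith))

section ModeMul

variable {H : Type*} [NormedAddCommGroup H] [InnerProductSpace ℝ H] {d : ℕ} {n : Fin d → ℕ}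

/-- The mode-`k` product of a function-valued tensor with a square matrix. -/
noncomputable def modeMul (k : Fin d) (P : Matrix (Fin (n k)) (Fin (n k)) ℝ)
    (X : (∀ l, Fin (n l)) → H) : (∀ l, Fin (n l)) → H :=
  fun i => ∑ b, P (i k) b • X (Function.update i k b)

theorem modeMul_sub (k : Fin d) (P : Matrix (Fin (n k)) (Fin (n k)) ℝ)
    (X Y : (∀ l, Fin (n l)) → H) : modeMul k P (X - Y) = modeMul k P X - modeMul k P Y := by
  ext i
  simp [modeMul, smul_sub, Finset.sum_sub_distrib]

theorem modeMul_modeMul_self (k : Fin d) (P Q : Matrix (Fin (n k)) (Fin (n k)) ℝ)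
    (X : (∀ l, Fin (n l)) → H) : modeMul k P (modeMul k Q X) = modeMul k (P * Q) X := by
  ext i
  simp only [modeMul, Function.update_self, Function.update_idem, Finset.smul_sum, smul_smul,
    Matrix.mul_apply, Finset.sum_smul]
  exact Finset.sum_comm

theorem modeMul_comm {k l : Fin d} (hkl : k ≠ l) (P : Matrix (Fin (n k)) (Fin (n k)) ℝ)
    (Q : Matrix (Fin (n l)) (Fin (n l)) ℝ) (X : (∀ l, Fin (n l)) → H) :
    modeMul k P (modeMul l Q X) = modeMul l Q (modeMul k P X) := by
  ext i
  simp only [modeMul, Function.update_of_ne hkl, Function.update_of_ne hkl.symm, Finset.smul_sum]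
  rw [Finset.sum_comm]
  refine Finset.sum_congr rfl fun a _ => Finset.sum_congr rfl fun b _ => ?_
  rw [smul_comm, Function.update_comm hkl]

theorem modeRank_modeMul_le {k : Fin d} {P : Matrix (Fin (n k)) (Fin (n k)) ℝ}
    (hP : IsIdempotentElem P) (X : (∀ l, Fin (n l)) → H) :
    (modeRank (modeMul k P X) k : ℝ) ≤ P.trace := by
  have h : (fun (a : Fin (n k)) (i : ∀ l, Fin (n l)) => modeMul k P X (Function.update i k a)) =
      fun a => ∑ b, P a b • fun i => X (Function.update i k b) := by
    ext a i
    simp [modeMul]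
  rw [modeRank, h]
  exact finrank_span_sum_smul_le_trace hP _

/-- A tensor is fixed in mode `k` by an orthogonal projection matrix whose trace is its
mode-`k` rank. -/
theorem exists_modeMul_eq_self (k : Fin d) (X : (∀ l, Fin (n l)) → H) :
    ∃ Q : Matrix (Fin (n k)) (Fin (n k)) ℝ, Q.IsSymm ∧ IsIdempotentElem Q ∧
      Q.trace = modeRank X k ∧ modeMul k Q X = X := by
  obtain ⟨Q, hs, hi, ht, hQ⟩ := exists_isSymm_isIdempotentElem_sum_smul_eq
    (fun (a : Fin (n k)) (i : ∀ l, Fin (n l)) => X (Function.update i k a))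
  refine ⟨Q, hs, hi, ht, ?_⟩
  ext i
  simpa [modeMul] using congrFun (hQ (i k)) i

theorem sum_inner_modeMul_left {k : Fin d} {P : Matrix (Fin (n k)) (Fin (n k)) ℝ}
    (hP : P.IsSymm) (X Y : (∀ l, Fin (n l)) → H) :
    ∑ i, inner ℝ (modeMul k P X i) (Y i) = ∑ i, inner ℝ (X i) (modeMul k P Y i) := by
  simp only [modeMul, sum_inner, inner_sum, inner_smul_left, inner_smul_right, RCLike.conj_to_real]
  rw [← Fintype.sum_prod_type', ← Fintype.sum_prod_type']
  refine Finset.sum_nbij' (fun p => (Function.update p.1 k p.2, p.1 k))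
    (fun p => (Function.update p.1 k p.2, p.1 k)) ?_ ?_ ?_ ?_ ?_
  · simp
  · simp
  · simp
  · simp
  · rintro ⟨i, b⟩ -
    simp [hP.apply]

theorem sq_l2Norm {E S : Type*} [NormedAddCommGroup E] [Fintype S] (v : S → E) :
    l2Norm v ^ 2 = ∑ s, ‖v s‖ ^ 2 :=
  Real.sq_sqrt (Finset.sum_nonneg fun _ _ => sq_nonneg _)

/-- Pythagoras for the orthogonal projection given by the mode-`k` product. -/
theorem sq_l2Norm_sub_modeMul {k : Fin d} {P : Matrix (Fin (n k)) (Fin (n k)) ℝ}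
    (hs : P.IsSymm) (hi : IsIdempotentElem P) (X Y : (∀ l, Fin (n l)) → H) :
    l2Norm (X - modeMul k P Y) ^ 2 =
      l2Norm (X - modeMul k P X) ^ 2 + l2Norm (modeMul k P (X - Y)) ^ 2 := by
  have horth : ∑ i, inner ℝ ((X - modeMul k P X) i) (modeMul k P (X - Y) i) = 0 := by
    rw [← sum_inner_modeMul_left hs, modeMul_sub, modeMul_modeMul_self, hi.eq, sub_self]
    simp
  have hsplit : X - modeMul k P Y = (X - modeMul k P X) + modeMul k P (X - Y) := by
    rw [modeMul_sub]
    abel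
  rw [hsplit]
  simp only [sq_l2Norm, Pi.add_apply, norm_add_sq_real, Finset.sum_add_distrib, ← Finset.mul_sum,
    horth]
  ring

theorem sq_l2Norm_modeMul_le {k : Fin d} {P : Matrix (Fin (n k)) (Fin (n k)) ℝ}
    (hs : P.IsSymm) (hi : IsIdempotentElem P) (X : (∀ l, Fin (n l)) → H) :
    l2Norm (modeMul k P X) ^ 2 ≤ l2Norm X ^ 2 := by
  have h := sq_l2Norm_sub_modeMul hs hi X 0
  have h0 : modeMul k P (0 : (∀ l, Fin (n l)) → H) = 0 := by
    ext i
    simp [modeMul]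
  rw [h0, sub_zero] at h
  nlinarith [sq_nonneg (l2Norm (X - modeMul k P X))]

/-- Among the orthogonal projection matrices of trace at most `r`, one is optimal for truncating a
tensor in mode `k`; the truncation is at least as close as any tensor of mode-`k` rank at
most `r`. -/
theorem exists_modeMul_optimal (k : Fin d) (A : (∀ l, Fin (n l)) → H) (r : ℕ) :
    ∃ P : Matrix (Fin (n k)) (Fin (n k)) ℝ, P.IsSymm ∧ IsIdempotentElem P ∧ P.trace ≤ r ∧
      ∀ C : (∀ l, Fin (n l)) → H, modeRank C k ≤ r →
        l2Norm (A - modeMul k P A) ^ 2 ≤ l2Norm (A - C) ^ 2 := by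
  have hcont : Continuous fun P : Matrix (Fin (n k)) (Fin (n k)) ℝ =>
      l2Norm (A - modeMul k P A) ^ 2 := by
    simp only [sq_l2Norm, Pi.sub_apply, modeMul]
    fun_prop
  obtain ⟨P, ⟨hs, hi, ht⟩, hmin⟩ :=
    (isCompact_setOf_isSymm_isIdempotentElem_trace_le (Fin (n k)) r).exists_isMinOn
      ⟨0, Matrix.isSymm_zero, IsIdempotentElem.zero, by simp⟩ hcont.continuousOn
  refine ⟨P, hs, hi, ht, fun C hC => ?_⟩
  obtain ⟨Q, hQs, hQi, hQt, hQC⟩ := exists_modeMul_eq_self k C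
  have hPQ : l2Norm (A - modeMul k P A) ^ 2 ≤ l2Norm (A - modeMul k Q A) ^ 2 :=
    hmin ⟨hQs, hQi, by rw [hQt]; exact_mod_cast hC⟩
  have hpyth := sq_l2Norm_sub_modeMul hQs hQi A C
  rw [hQC] at hpyth
  nlinarith [sq_nonneg (l2Norm (modeMul k Q (A - C)))]

/-- Truncating successively in the modes of `s` yields a tensor fixed by all the projections,
whose squared error is at most the sum of the squared single-mode errors. -/
theorem exists_forall_modeMul_eq_self (A : (∀ l, Fin (n l)) → H)
    (P : ∀ k, Matrix (Fin (n k)) (Fin (n k)) ℝ) (hs : ∀ k, (P k).IsSymm)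
    (hi : ∀ k, IsIdempotentElem (P k)) (s : Finset (Fin d)) :
    ∃ B : (∀ l, Fin (n l)) → H, (∀ k ∈ s, modeMul k (P k) B = B) ∧
      l2Norm (A - B) ^ 2 ≤ ∑ k ∈ s, l2Norm (A - modeMul k (P k) A) ^ 2 := by
  induction s using Finset.induction_on with
  | empty => exact ⟨A, by simp, by simp [sq_l2Norm]⟩
  | insert k s hk ih =>
    obtain ⟨B, hB, hle⟩ := ih
    refine ⟨modeMul k (P k) B, fun l hl => ?_, ?_⟩
    · rcases eq_or_ne l k with rfl | hlk
      · rw [modeMul_modeMul_self, (hi l).eq]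
      · rw [modeMul_comm hlk, hB l (Finset.mem_of_mem_insert_of_ne hl hlk)]
    · rw [Finset.sum_insert hk, sq_l2Norm_sub_modeMul (hs k) (hi k)]
      gcongr
      exact (sq_l2Norm_modeMul_le (hs k) (hi k) _).trans hle

end ModeMul

/-- **Quasi-optimality of the truncated higher-order SVD for function-valued tensors.**
Let `H` be a real Hilbert space, `A` a function-valued tensor of size `n` over `H`, and
`r k ≤` (mode-`k` rank of `A`) for every `k`. Then there exists a tensor `B` of mode-`k`
rank at most `r k` for every `k`, such that for every tensor `C` of mode-`k` rank at most
`r k` for every `k`, one has `‖A − B‖ ≤ √d · ‖A − C‖` in the `ℓ2(H)`-norm. -/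
theorem hosvd_quasi_optimal {H : Type*} [NormedAddCommGroup H] [InnerProductSpace ℝ H]
    [CompleteSpace H] {d : ℕ} {n : Fin d → ℕ}
    (A : (∀ k : Fin d, Fin (n k)) → H) (r : Fin d → ℕ)
    (hr : ∀ k : Fin d, r k ≤ modeRank A k) :
    ∃ B : (∀ k : Fin d, Fin (n k)) → H,
      (∀ k : Fin d, modeRank B k ≤ r k) ∧
      ∀ C : (∀ k : Fin d, Fin (n k)) → H,
        (∀ k : Fin d, modeRank C k ≤ r k) →
        l2Norm (fun i => A i - B i) ≤ Real.sqrt d * l2Norm (fun i => A i - C i) := by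
  choose P hs hi ht hopt using fun k => exists_modeMul_optimal k A (r k)
  obtain ⟨B, hB, hle⟩ := exists_forall_modeMul_eq_self A P hs hi Finset.univ
  refine ⟨B, fun k => ?_, fun C hC => ?_⟩
  · have h := (modeRank_modeMul_le (hi k) B).trans (ht k)
    rw [hB k (Finset.mem_univ k)] at h
    exact_mod_cast h
  · change l2Norm (A - B) ≤ √d * l2Norm (A - C)
    refine le_of_sq_le_sq (hle.trans ?_) (by unfold l2Norm; positivity)
    rw [mul_pow, Real.sq_sqrt (Nat.cast_nonneg d)]
    calc ∑ k, l2Norm (A - modeMul k (P k) A) ^ 2 ≤ ∑ _k : Fin d, l2Norm (A - C) ^ 2 :=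
          Finset.sum_le_sum fun k _ => hopt k C (hC k)
      _ = d * l2Norm (A - C) ^ 2 := by simp
end
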